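/- Let q ≥ 1 and n ≥ 2 be integers and let X be a connected (q+1)-regular simple undirected graph on n vertices. Then μ(X) ≤ 2 if and only if both of the following hold: |N_k − q^k − 1| ≤ 2(n−1)·q^{k/2} for all odd integers k ≥ 1, and |N_k − n(q−1) − q^k − 1| ≤ 2(n−1)·q^{k/2} for all even integers k ≥ 2. -/

import Mathlib

open Matrix Filter

noncomputable section

/-- The non-backtracking (Hashimoto) matrix of a graph, indexed by darts:
`W e f = 1` if the end of `e` is the start of `f` and `f` is not the reversal of `e`. -/
def hashimoto {n : ℕ} (X : SimpleGraph (Fin n)) [DecidableRel X.Adj] :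
    Matrix X.Dart X.Dart ℝ :=
  Matrix.of fun e f => if e.toProd.2 = f.toProd.1 ∧ f ≠ e.symm then 1 else 0

/-- `N_k = trace(W^k)`, the number of geodesic cycles of length `k`. -/
def Ngc {n : ℕ} (X : SimpleGraph (Fin n)) [DecidableRel X.Adj] (k : ℕ) : ℝ :=
  (hashimoto X ^ k).trace

/-- The sequence `H_k`. -/
def Hseq (q : ℕ) {n : ℕ} (X : SimpleGraph (Fin n)) [DecidableRel X.Adj] (k : ℕ) : ℝ :=
  if Odd k then
    2 * ((n : ℝ) - 1) + Real.sqrt q ^ k + (Real.sqrt q ^ k)⁻¹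
      - (Real.sqrt q ^ k)⁻¹ * Ngc X k
  else
    2 * ((n : ℝ) - 1) + Real.sqrt q ^ k + (Real.sqrt q ^ k)⁻¹
      - (Real.sqrt q ^ k)⁻¹ * (Ngc X k - (n : ℝ) * ((q : ℝ) - 1))

/-- `μ(X) = q^{-1/2} · max_{2 ≤ i ≤ n} |λ_i|`, where `lam` enumerates the eigenvalues
in decreasing order (indices starting from `0`). -/
def mu (q : ℕ) {n : ℕ} (lam : Fin n → ℝ) : ℝ :=
  (Real.sqrt q)⁻¹ * sSup {x : ℝ | ∃ i : Fin n, (i : ℕ) ≠ 0 ∧ x = |lam i|}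

section Incidence

variable {V : Type*} [Fintype V] [DecidableEq V] (X : SimpleGraph V) [DecidableRel X.Adj]

/-- The vertex-by-dart matrix recording the initial vertex of each dart. -/
def dartSource : Matrix V X.Dart ℝ := Matrix.of fun v e => if e.fst = v then 1 else 0

/-- The vertex-by-dart matrix recording the terminal vertex of each dart. -/
def dartTarget : Matrix V X.Dart ℝ := Matrix.of fun v e => if e.snd = v then 1 else 0

/-- The permutation matrix of dart reversal. -/
def dartReversal : Matrix X.Dart X.Dart ℝ := Matrix.of fun e f => if e = f.symm then 1 else 0

theorem dartSource_mul_dartReversal : dartSource X * dartReversal X = dartTarget X := by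
  ext v e
  simp only [Matrix.mul_apply, dartSource, dartTarget, dartReversal, Matrix.of_apply]
  rw [Finset.sum_eq_single e.symm] <;> simp +contextual

theorem dartTarget_mul_dartReversal : dartTarget X * dartReversal X = dartSource X := by
  ext v e
  simp only [Matrix.mul_apply, dartSource, dartTarget, dartReversal, Matrix.of_apply]
  rw [Finset.sum_eq_single e.symm] <;> simp +contextual

theorem dartReversal_mul_self : dartReversal X * dartReversal X = 1 := by
  ext e f
  simp [Matrix.mul_apply, dartReversal, Matrix.one_apply]

theorem trace_dartReversal : (dartReversal X).trace = 0 := by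
  refine Finset.sum_eq_zero fun e _ => ?_
  simp [dartReversal, (e.symm_ne).symm]

theorem dartSource_mul_dartTarget_transpose :
    dartSource X * (dartTarget X)ᵀ = X.adjMatrix ℝ := by
  ext v w
  simp only [Matrix.mul_apply, dartSource, dartTarget, Matrix.transpose_apply, Matrix.of_apply,
    SimpleGraph.adjMatrix_apply]
  by_cases h : X.Adj v w
  · rw [if_pos h, Finset.sum_eq_single (⟨(v, w), h⟩ : X.Dart)]
    · simp
    · intro e _ he
      by_cases h1 : e.fst = v
      · by_cases h2 : e.snd = w
        · exact absurd (SimpleGraph.Dart.ext _ _ (Prod.ext h1 h2)) he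
        · simp [h2]
      · simp [h1]
    · simp
  · rw [if_neg h]
    refine Finset.sum_eq_zero fun e _ => ?_
    by_cases h1 : e.fst = v
    · by_cases h2 : e.snd = w
      · exact absurd (h1 ▸ h2 ▸ e.adj) h
      · simp [h2]
    · simp [h1]

variable {X}

theorem dartTarget_mul_dartTarget_transpose {d : ℕ} (hreg : X.IsRegularOfDegree d) :
    dartTarget X * (dartTarget X)ᵀ = (d : ℝ) • (1 : Matrix V V ℝ) := by
  ext v w
  simp only [Matrix.mul_apply, dartTarget, Matrix.transpose_apply, Matrix.of_apply,
    Matrix.smul_apply, Matrix.one_apply]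
  by_cases h : v = w
  · subst h
    have hcard : (Finset.univ.filter fun e : X.Dart => e.snd = v).card = d := by
      rw [← hreg v, ← X.dart_fst_fiber_card_eq_degree v]
      refine Finset.card_bij (fun e _ => e.symm) ?_ ?_ ?_
      · simp
      · intro a _ b _ hab
        exact SimpleGraph.Dart.symm_involutive.injective hab
      · intro b hb
        exact ⟨b.symm, by simpa using hb, by simp⟩
    simp [← ite_and, hcard]
  · rw [if_neg h, smul_zero]
    refine Finset.sum_eq_zero fun e _ => ?_
    by_cases h1 : e.snd = v
    · simp [h1, h]
    · simp [h1]

end Incidence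

theorem card_dart_of_isRegularOfDegree {V : Type*} [Fintype V] {X : SimpleGraph V}
    [DecidableRel X.Adj] {d : ℕ} (hreg : X.IsRegularOfDegree d) :
    Fintype.card X.Dart = Fintype.card V * d := by
  simp [X.dart_card_eq_sum_degrees, hreg.degree_eq]

/-- The rescaled Chebyshev sequence `2, x, x² - 2q, …`, whose value at `a + b` with `ab = q` is
`a ^ k + b ^ k`. -/
def powerSumSeq {R : Type*} [Ring R] [Algebra ℝ R] (q : ℝ) (x : R) : ℕ → R
  | 0 => 2
  | 1 => x
  | k + 2 => x * powerSumSeq q x (k + 1) - q • powerSumSeq q x k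

theorem powerSumSeq_add_two {R : Type*} [Ring R] [Algebra ℝ R] (q : ℝ) (x : R) (k : ℕ) :
    powerSumSeq q x (k + 2) = x * powerSumSeq q x (k + 1) - q • powerSumSeq q x k :=
  rfl

theorem powerSumSeq_add {R : Type*} [CommRing R] [Algebra ℝ R] {q : ℝ} {a b : R}
    (hab : a * b = algebraMap ℝ R q) (k : ℕ) : powerSumSeq q (a + b) k = a ^ k + b ^ k := by
  induction k using Nat.twoStepInduction with
  | zero => simp [powerSumSeq, one_add_one_eq_two]
  | one => simp [powerSumSeq]
  | more k h0 h1 =>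
    rw [powerSumSeq, h0, h1, Algebra.smul_def, ← hab]
    ring

theorem powerSumSeq_map {R S : Type*} [Ring R] [Algebra ℝ R] [Ring S] [Algebra ℝ S]
    (f : R →ₐ[ℝ] S) (q : ℝ) (x : R) (k : ℕ) :
    f (powerSumSeq q x k) = powerSumSeq q (f x) k := by
  induction k using Nat.twoStepInduction with
  | zero => exact map_ofNat f 2
  | one => simp [powerSumSeq]
  | more k h0 h1 => simp [powerSumSeq, h0, h1]

theorem abs_powerSumSeq_le {q x : ℝ} (hq : 0 < q) (hx : |x| ≤ 2 * √q) (k : ℕ) :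
    |powerSumSeq q x k| ≤ 2 * √q ^ k := by
  have hs : 0 < √q := Real.sqrt_pos.2 hq
  obtain ⟨h1, h2⟩ := abs_le.1 hx
  set θ := Real.arccos (x / (2 * √q)) with hθ
  have hcos : x = 2 * √q * Real.cos θ := by
    rw [hθ, Real.cos_arccos]
    · field_simp
    · rw [le_div_iff₀ (by positivity)]; linarith
    · rw [div_le_iff₀ (by positivity)]; linarith
  have key : powerSumSeq q x k = 2 * √q ^ k * Real.cos (k * θ) := by
    induction k using Nat.twoStepInduction with
    | zero => simp [powerSumSeq]
    | one => simp [powerSumSeq, hcos]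
    | more k h0 h1 =>
      have hadd : Real.cos ((k + 2 : ℕ) * θ) + Real.cos (k * θ) =
          2 * Real.cos θ * Real.cos ((k + 1 : ℕ) * θ) := by
        rw [Real.cos_add_cos]
        push_cast
        ring_nf
      have hc : Real.cos ((k + 2 : ℕ) * θ) =
          2 * Real.cos θ * Real.cos ((k + 1 : ℕ) * θ) - Real.cos (k * θ) := by linarith
      rw [powerSumSeq, h0, h1, hc, smul_eq_mul]
      have hsq : √q ^ 2 = q := Real.sq_sqrt hq.le
      rw [pow_add _ k 2, hsq]
      nth_rewrite 1 [hcos]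
      linear_combination (4 * √q ^ k * Real.cos θ * Real.cos ((k + 1 : ℕ) * θ)) * hsq
  rw [key, abs_mul, abs_of_pos (by positivity : 0 < 2 * √q ^ k)]
  exact mul_le_of_le_one_right (by positivity) (Real.abs_cos_le_one _)

theorem exists_pow_le_powerSumSeq {q x : ℝ} (hq : 0 < q) (hx : 2 * √q < |x|) :
    ∃ r : ℝ, 1 < r ∧ ∀ k : ℕ, Even k → √q ^ k * r ^ k ≤ powerSumSeq q x k := by
  have hs : 0 < √q := Real.sqrt_pos.2 hq
  have hsq : √q ^ 2 = q := Real.sq_sqrt hq.le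
  have hd : 0 < |x| ^ 2 - 4 * q := by nlinarith
  have hdsq := Real.sq_sqrt hd.le
  have hd0 := Real.sqrt_nonneg (|x| ^ 2 - 4 * q)
  set d := √(|x| ^ 2 - 4 * q)
  refine ⟨(|x| + d) / 2 / √q, by rw [one_lt_div hs]; linarith, fun k hk => ?_⟩
  have hprod : (|x| + d) / 2 * ((|x| - d) / 2) = algebraMap ℝ ℝ q := by
    rw [Algebra.algebraMap_self_apply]
    linear_combination -hdsq / 4
  have hpow : powerSumSeq q x k = ((|x| + d) / 2) ^ k + ((|x| - d) / 2) ^ k := by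
    rcases abs_choice x with h | h
    · rw [← powerSumSeq_add hprod, ← h]
      congr 1
      simp only [abs_abs]
      ring
    · rw [← hk.neg_pow, ← hk.neg_pow ((|x| - d) / 2), ← powerSumSeq_add (q := q)]
      · congr 1
        linarith
      · rw [neg_mul_neg, hprod]
  rw [← mul_pow, mul_div_cancel₀ _ hs.ne', hpow]
  linarith [hk.pow_nonneg ((|x| - d) / 2)]

theorem neg_le_powerSumSeq {q x : ℝ} (hq : 0 < q) {k : ℕ} (hk : Even k) :
    -(2 * √q ^ k) ≤ powerSumSeq q x k := by
  rcases le_or_gt |x| (2 * √q) with hx | hx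
  · exact (abs_le.1 (abs_powerSumSeq_le hq hx k)).1
  · obtain ⟨r, hr, h⟩ := exists_pow_le_powerSumSeq hq hx
    have : 0 ≤ √q ^ k * r ^ k := by positivity
    have : 0 ≤ √q ^ k := by positivity
    linarith [h k hk]

theorem abs_le_of_sum_powerSumSeq_le {ι : Type*} {s : Finset ι} {q C : ℝ} (hq : 0 < q)
    {f : ι → ℝ} (h : ∀ k : ℕ, 2 ≤ k → Even k → ∑ i ∈ s, powerSumSeq q (f i) k ≤ C * √q ^ k)
    {i : ι} (hi : i ∈ s) : |f i| ≤ 2 * √q := by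
  classical
  by_contra! hx
  obtain ⟨r, hr, hrk⟩ := exists_pow_le_powerSumSeq hq hx
  obtain ⟨m, hm⟩ := pow_unbounded_of_one_lt (C + 2 * (s.card : ℝ)) hr
  have hk : Even (2 * (m + 1)) := even_two_mul _
  have hlow : ∑ j ∈ s.erase i, -(2 * √q ^ (2 * (m + 1))) ≤
      ∑ j ∈ s.erase i, powerSumSeq q (f j) (2 * (m + 1)) :=
    Finset.sum_le_sum fun j _ => neg_le_powerSumSeq hq hk
  have hup := h _ (by omega) hk
  rw [← Finset.add_sum_erase s _ hi] at hup
  have hpow : 0 < √q ^ (2 * (m + 1)) := pow_pos (Real.sqrt_pos.2 hq) _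
  have hcard : ((s.erase i).card : ℝ) ≤ s.card := by exact_mod_cast Finset.card_erase_le
  rw [Finset.sum_const, nsmul_eq_mul] at hlow
  have hr' : r ^ m ≤ r ^ (2 * (m + 1)) := pow_le_pow_right₀ hr.le (by omega)
  have := hrk _ hk
  nlinarith

theorem Matrix.IsHermitian.trace_powerSumSeq {ι : Type*} [Fintype ι] [DecidableEq ι]
    {A : Matrix ι ι ℝ} (hA : A.IsHermitian) (q : ℝ) (k : ℕ) :
    (powerSumSeq q A k).trace = ∑ i, powerSumSeq q (hA.eigenvalues i) k := by
  have hdiag : powerSumSeq q (Matrix.diagonal hA.eigenvalues) k =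
      Matrix.diagonal fun i => powerSumSeq q (hA.eigenvalues i) k := by
    have h := powerSumSeq_map (Matrix.diagonalAlgHom (n := ι) (α := ℝ) ℝ) q hA.eigenvalues k
    rw [Matrix.diagonalAlgHom_apply, Matrix.diagonalAlgHom_apply] at h
    rw [← h]
    congr 1
    funext i
    exact powerSumSeq_map (Pi.evalAlgHom ℝ (fun _ : ι => ℝ) i) q hA.eigenvalues k
  have hconj := powerSumSeq_map
    (Unitary.conjStarAlgAut ℝ (Matrix ι ι ℝ) hA.eigenvectorUnitary).toAlgEquiv.toAlgHom q
    (Matrix.diagonal hA.eigenvalues) k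
  have hspec : (Unitary.conjStarAlgAut ℝ (Matrix ι ι ℝ)
      hA.eigenvectorUnitary).toAlgEquiv.toAlgHom (Matrix.diagonal hA.eigenvalues) = A :=
    hA.spectral_theorem.symm
  rw [hspec, hdiag] at hconj
  rw [← hconj]
  change Matrix.trace (Unitary.conjStarAlgAut ℝ (Matrix ι ι ℝ) hA.eigenvectorUnitary _) = _
  rw [Unitary.conjStarAlgAut_apply, Matrix.trace_mul_comm, ← Matrix.mul_assoc,
    Unitary.coe_star_mul_self, Matrix.one_mul, Matrix.trace_diagonal]

theorem SimpleGraph.IsRegularOfDegree.eigenvalues_le {V : Type*} [Fintype V] [DecidableEq V]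
    {X : SimpleGraph V} [DecidableRel X.Adj] {d : ℕ} (hreg : X.IsRegularOfDegree d)
    (hA : (X.adjMatrix ℝ).IsHermitian) (i : V) : hA.eigenvalues i ≤ d := by
  have hmem := hA.eigenvalues_mem_spectrum_real i
  rw [← Matrix.spectrum_toLin', ← Module.End.hasEigenvalue_iff_mem_spectrum] at hmem
  obtain ⟨v, hv⟩ := eigenvalue_mem_ball hmem
  have hsum : ∑ w ∈ Finset.univ.erase v, ‖X.adjMatrix ℝ v w‖ ≤ d := by
    refine (Finset.sum_le_univ_sum_of_nonneg fun _ => norm_nonneg _).trans_eq ?_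
    rw [← hreg.degree_eq v, X.degree_eq_sum_if_adj]
    exact Finset.sum_congr rfl fun w _ => by
      rw [SimpleGraph.adjMatrix_apply]
      split_ifs <;> simp
  rw [Metric.mem_closedBall, SimpleGraph.adjMatrix_apply, if_neg (X.loopless.irrefl v),
    dist_zero_right] at hv
  exact (le_abs_self _).trans (hv.trans hsum)

theorem SimpleGraph.IsRegularOfDegree.exists_eigenvalues_eq {V : Type*} [Fintype V]
    [DecidableEq V] [Nonempty V]
    {X : SimpleGraph V} [DecidableRel X.Adj] {d : ℕ} (hreg : X.IsRegularOfDegree d)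
    (hA : (X.adjMatrix ℝ).IsHermitian) : ∃ i, hA.eigenvalues i = d := by
  rw [← Set.mem_range, ← hA.spectrum_real_eq_range_eigenvalues, ← Matrix.spectrum_toLin',
    ← Module.End.hasEigenvalue_iff_mem_spectrum]
  refine Module.End.hasEigenvalue_of_hasEigenvector (x := fun _ => 1)
    (Module.End.hasEigenvector_iff.2 ⟨Module.End.mem_eigenspace_iff.2 ?_, ?_⟩)
  · ext v
    simp [Matrix.toLin'_apply, hreg.degree_eq]
  · exact fun h => one_ne_zero (congrFun h (Classical.arbitrary V))

section Hashimoto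

variable {n : ℕ} (X : SimpleGraph (Fin n)) [DecidableRel X.Adj]

theorem hashimoto_eq : hashimoto X = (dartTarget X)ᵀ * dartSource X - dartReversal X := by
  ext e f
  simp only [hashimoto, dartTarget, dartSource, dartReversal, Matrix.mul_apply, Matrix.sub_apply,
    Matrix.of_apply, Matrix.transpose_apply]
  by_cases h : f = e.symm
  · simp [h]
  · have h' : e ≠ f.symm := fun he => h (by simp [he])
    simp [h, h', eq_comm]

variable {X} {q : ℕ}

theorem dartTarget_mul_hashimoto (hreg : X.IsRegularOfDegree (q + 1)) :
    dartTarget X * hashimoto X = (q : ℝ) • dartSource X := by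
  rw [hashimoto_eq, Matrix.mul_sub, ← Matrix.mul_assoc, dartTarget_mul_dartTarget_transpose hreg,
    dartTarget_mul_dartReversal, Matrix.smul_mul, Matrix.one_mul]
  push_cast
  module

variable (X) in
theorem dartSource_mul_hashimoto :
    dartSource X * hashimoto X = X.adjMatrix ℝ * dartSource X - dartTarget X := by
  rw [hashimoto_eq, Matrix.mul_sub, ← Matrix.mul_assoc, dartSource_mul_dartTarget_transpose,
    dartSource_mul_dartReversal]

variable (X) in
/-- The matrix counting non-backtracking walks of length `k + 1` between two vertices. -/
def nonbacktrackingWalks (k : ℕ) : Matrix (Fin n) (Fin n) ℝ :=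
  dartSource X * hashimoto X ^ k * (dartTarget X)ᵀ

theorem nonbacktrackingWalks_zero : nonbacktrackingWalks X 0 = X.adjMatrix ℝ := by
  simp [nonbacktrackingWalks, dartSource_mul_dartTarget_transpose]

theorem nonbacktrackingWalks_one (hreg : X.IsRegularOfDegree (q + 1)) :
    nonbacktrackingWalks X 1 = X.adjMatrix ℝ * X.adjMatrix ℝ - ((q : ℝ) + 1) • 1 := by
  rw [nonbacktrackingWalks, pow_one, dartSource_mul_hashimoto, Matrix.sub_mul, Matrix.mul_assoc,
    dartSource_mul_dartTarget_transpose, dartTarget_mul_dartTarget_transpose hreg]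
  push_cast
  rfl

theorem nonbacktrackingWalks_add_two (hreg : X.IsRegularOfDegree (q + 1)) (k : ℕ) :
    nonbacktrackingWalks X (k + 2) =
      X.adjMatrix ℝ * nonbacktrackingWalks X (k + 1) - (q : ℝ) • nonbacktrackingWalks X k := by
  have h : dartTarget X * hashimoto X ^ (k + 1) = (q : ℝ) • (dartSource X * hashimoto X ^ k) := by
    rw [pow_succ', ← Matrix.mul_assoc, dartTarget_mul_hashimoto hreg, Matrix.smul_mul]
  rw [nonbacktrackingWalks, pow_succ' _ (k + 1), ← Matrix.mul_assoc, dartSource_mul_hashimoto,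
    Matrix.sub_mul, h, Matrix.sub_mul, Matrix.smul_mul, nonbacktrackingWalks,
    nonbacktrackingWalks]
  simp only [Matrix.mul_assoc]

theorem nonbacktrackingWalks_sub (hreg : X.IsRegularOfDegree (q + 1)) (k : ℕ) :
    nonbacktrackingWalks X (k + 2) - (q : ℝ) • nonbacktrackingWalks X k =
      powerSumSeq (q : ℝ) (X.adjMatrix ℝ) (k + 3) -
        powerSumSeq (q : ℝ) (X.adjMatrix ℝ) (k + 1) := by
  have h2 : (2 : Matrix (Fin n) (Fin n) ℝ) = (2 : ℝ) • 1 := by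
    rw [two_smul, one_add_one_eq_two]
  induction k using Nat.twoStepInduction with
  | zero =>
    simp only [nonbacktrackingWalks_add_two hreg, nonbacktrackingWalks_zero,
      nonbacktrackingWalks_one hreg, powerSumSeq, zero_add, h2]
    simp only [mul_sub, mul_smul_comm, mul_one]
    module
  | one =>
    simp only [nonbacktrackingWalks_add_two hreg, nonbacktrackingWalks_zero,
      nonbacktrackingWalks_one hreg, powerSumSeq, zero_add, h2, Nat.reduceAdd]
    simp only [mul_sub, mul_smul_comm, mul_one, smul_sub]
    module
  | more k h0 h1 =>
    calc nonbacktrackingWalks X (k + 2 + 2) - (q : ℝ) • nonbacktrackingWalks X (k + 2)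
      _ = X.adjMatrix ℝ *
            (nonbacktrackingWalks X (k + 1 + 2) - (q : ℝ) • nonbacktrackingWalks X (k + 1)) -
          (q : ℝ) • (nonbacktrackingWalks X (k + 2) - (q : ℝ) • nonbacktrackingWalks X k) := by
        rw [add_right_comm k 1 2, nonbacktrackingWalks_add_two hreg (k + 2),
          nonbacktrackingWalks_add_two hreg k]
        simp only [mul_sub, smul_sub, mul_smul_comm]
        module
      _ = powerSumSeq (q : ℝ) (X.adjMatrix ℝ) (k + 3 + 2) -
            powerSumSeq (q : ℝ) (X.adjMatrix ℝ) (k + 1 + 2) := by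
        rw [h0, h1, powerSumSeq_add_two _ _ (k + 3), powerSumSeq_add_two _ _ (k + 1)]
        simp only [mul_sub, smul_sub]
        module

theorem trace_hashimoto_pow_mul_dartReversal (k : ℕ) :
    (hashimoto X ^ (k + 1) * dartReversal X).trace =
      (dartTarget X * hashimoto X ^ k * (dartTarget X)ᵀ).trace - Ngc X k := by
  rw [pow_succ, Matrix.mul_assoc]
  nth_rewrite 2 [hashimoto_eq]
  rw [Matrix.sub_mul, Matrix.mul_assoc, dartSource_mul_dartReversal, dartReversal_mul_self,
    Matrix.mul_sub, Matrix.trace_sub, Matrix.mul_one, Ngc, ← Matrix.mul_assoc,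
    Matrix.trace_mul_comm, Matrix.mul_assoc]

theorem Ngc_succ (k : ℕ) :
    Ngc X (k + 1) =
      (nonbacktrackingWalks X k).trace - (hashimoto X ^ k * dartReversal X).trace := by
  rw [Ngc, pow_succ]
  nth_rewrite 2 [hashimoto_eq]
  rw [Matrix.mul_sub, Matrix.trace_sub, ← Matrix.mul_assoc, Matrix.trace_mul_comm,
    nonbacktrackingWalks, Matrix.mul_assoc]

theorem Ngc_add_three (hreg : X.IsRegularOfDegree (q + 1)) (k : ℕ) :
    Ngc X (k + 3) = Ngc X (k + 1) + (powerSumSeq (q : ℝ) (X.adjMatrix ℝ) (k + 3)).trace -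
      (powerSumSeq (q : ℝ) (X.adjMatrix ℝ) (k + 1)).trace := by
  have h := congrArg Matrix.trace (nonbacktrackingWalks_sub hreg k)
  rw [Matrix.trace_sub, Matrix.trace_sub, Matrix.trace_smul] at h
  rw [Ngc_succ, trace_hashimoto_pow_mul_dartReversal, pow_succ', ← Matrix.mul_assoc,
    dartTarget_mul_hashimoto hreg, Matrix.smul_mul, Matrix.smul_mul, Matrix.trace_smul,
    ← nonbacktrackingWalks]
  linarith

/-- The number of geodesic cycles in terms of the spectrum of the adjacency matrix. -/
theorem Ngc_eq (hreg : X.IsRegularOfDegree (q + 1)) (k : ℕ) (hk : 1 ≤ k) :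
    Ngc X k = (powerSumSeq (q : ℝ) (X.adjMatrix ℝ) k).trace +
      if Even k then (n : ℝ) * ((q : ℝ) - 1) else 0 := by
  obtain ⟨k, rfl⟩ := Nat.exists_eq_add_of_le' hk
  induction k using Nat.twoStepInduction with
  | zero =>
    rw [Ngc_succ, nonbacktrackingWalks_zero, pow_zero, Matrix.one_mul, trace_dartReversal]
    simp [powerSumSeq]
  | one =>
    have hcard := card_dart_of_isRegularOfDegree hreg
    rw [Ngc_succ, nonbacktrackingWalks_one hreg, ← zero_add 1,
      trace_hashimoto_pow_mul_dartReversal, Ngc, pow_zero, Matrix.mul_one,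
      dartTarget_mul_dartTarget_transpose hreg]
    have h2 : (2 : Matrix (Fin n) (Fin n) ℝ) = (2 : ℝ) • 1 := by
      rw [two_smul, one_add_one_eq_two]
    simp [powerSumSeq, hcard, h2, Matrix.trace_sub]
    ring
  | more k h0 h1 =>
    rw [Ngc_add_three hreg, h0 (by omega)]
    have : Even (k + 2 + 1) ↔ Even (k + 1) := by grind
    simp only [this]
    ring

end Hashimoto

theorem mu_le_two_iff_Nk_bounds {q n : ℕ} (hq : 1 ≤ q) (hn : 2 ≤ n)
    (X : SimpleGraph (Fin n)) [DecidableRel X.Adj]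
    (hconn : X.Connected) (hreg : X.IsRegularOfDegree (q + 1))
    (hA : (X.adjMatrix ℝ).IsHermitian)
    (lam : Fin n → ℝ)
    (hperm : ∃ σ : Equiv.Perm (Fin n), ∀ i, lam i = hA.eigenvalues (σ i))
    (hanti : ∀ i j : Fin n, i ≤ j → lam j ≤ lam i) :
    mu q lam ≤ 2 ↔
      ((∀ k : ℕ, 1 ≤ k → Odd k →
          |Ngc X k - (q : ℝ) ^ k - 1| ≤ 2 * ((n : ℝ) - 1) * Real.sqrt q ^ k) ∧
       (∀ k : ℕ, 2 ≤ k → Even k →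
          |Ngc X k - (n : ℝ) * ((q : ℝ) - 1) - (q : ℝ) ^ k - 1| ≤
            2 * ((n : ℝ) - 1) * Real.sqrt q ^ k)) := by
  have hq0 : (0 : ℝ) < q := by exact_mod_cast hq
  have hs : 0 < √(q : ℝ) := Real.sqrt_pos.2 hq0
  let i₀ : Fin n := ⟨0, by omega⟩
  have : Nonempty (Fin n) := ⟨i₀⟩
  obtain ⟨σ, hσ⟩ := hperm
  have hlam₀ : lam i₀ = q + 1 := by
    obtain ⟨j, hj⟩ := hreg.exists_eigenvalues_eq hA
    apply le_antisymm
    · rw [hσ]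
      exact_mod_cast hreg.eigenvalues_le hA _
    · have := hanti i₀ (σ.symm j) (Nat.zero_le _)
      rw [hσ (σ.symm j), Equiv.apply_symm_apply, hj] at this
      exact_mod_cast this
  have htrace (k : ℕ) : (powerSumSeq (q : ℝ) (X.adjMatrix ℝ) k).trace =
      (q : ℝ) ^ k + 1 + ∑ i ∈ Finset.univ.erase i₀, powerSumSeq (q : ℝ) (lam i) k := by
    have h₀ : powerSumSeq (q : ℝ) (lam i₀) k = (q : ℝ) ^ k + 1 := by
      rw [hlam₀, powerSumSeq_add (by simp), one_pow]
    rw [hA.trace_powerSumSeq, ← Equiv.sum_comp σ, ← h₀,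
      Finset.add_sum_erase _ (fun i => powerSumSeq (q : ℝ) (lam i) k) (Finset.mem_univ i₀)]
    simp only [hσ]
  have hmu : mu q lam ≤ 2 ↔ ∀ i ∈ Finset.univ.erase i₀, |lam i| ≤ 2 * √(q : ℝ) := by
    have hset : {x : ℝ | ∃ i : Fin n, (i : ℕ) ≠ 0 ∧ x = |lam i|} =
        (fun i => |lam i|) '' {i | (i : ℕ) ≠ 0} := by
      ext x
      simp [eq_comm]
    rw [mu, hset, inv_mul_le_iff₀ hs, mul_comm, csSup_le_iff (Set.toFinite _).bddAbove
      ⟨_, Set.mem_image_of_mem _ (show (⟨1, by omega⟩ : Fin n) ∈ _ from one_ne_zero)⟩]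
    simp [i₀, Fin.ext_iff]
  have hodd (k : ℕ) (hk : 1 ≤ k) (hk' : Odd k) : Ngc X k - (q : ℝ) ^ k - 1 =
      ∑ i ∈ Finset.univ.erase i₀, powerSumSeq (q : ℝ) (lam i) k := by
    rw [Ngc_eq hreg k hk, htrace, if_neg (Nat.not_even_iff_odd.2 hk')]
    ring
  have heven (k : ℕ) (hk : 2 ≤ k) (hk' : Even k) :
      Ngc X k - (n : ℝ) * ((q : ℝ) - 1) - (q : ℝ) ^ k - 1 =
        ∑ i ∈ Finset.univ.erase i₀, powerSumSeq (q : ℝ) (lam i) k := by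
    rw [Ngc_eq hreg k (by omega), htrace, if_pos hk']
    ring
  rw [hmu]
  constructor
  · intro h
    have hbound (k : ℕ) : |∑ i ∈ Finset.univ.erase i₀, powerSumSeq (q : ℝ) (lam i) k| ≤
        2 * ((n : ℝ) - 1) * √(q : ℝ) ^ k := by
      refine (Finset.abs_sum_le_sum_abs _ _).trans
        ((Finset.sum_le_sum fun i hi => abs_powerSumSeq_le hq0 (h i hi) k).trans_eq ?_)
      rw [Finset.sum_const, Finset.card_erase_of_mem (Finset.mem_univ _), Finset.card_univ,
        Fintype.card_fin, nsmul_eq_mul, Nat.cast_pred (by omega)]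
      ring
    exact ⟨fun k hk hk' => hodd k hk hk' ▸ hbound k, fun k hk hk' => heven k hk hk' ▸ hbound k⟩
  · rintro ⟨-, h⟩ i hi
    exact abs_le_of_sum_powerSumSeq_le hq0
      (fun k hk hk' => heven k hk hk' ▸ (le_abs_self _).trans (h k hk hk')) hi
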